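/- arXiv:1802.07643 — 6 statements merged into one kernel-verified Lean document; each statement's English description precedes it below -/
import Mathlib

section
/- For every constant M > 0, the symmetrizer S = M·P₋ᵀ·P₋ + P₊ᵀ·P₊ is a symmetric matrix and satisfies the coercivity estimate ⟨S·v, v⟩ ≥ α·‖v‖² for all v ∈ ℝ², where α = min(M, 1)/2 (first half of property (P1) of Lemma 3.2: the system is Friedrichs symmetrizable). -/
open Matrix

theorem isSymm_smul_transpose_mul_self_add {n : Type*} [Fintype n] (M : ℝ) (P Q : Matrix n n ℝ) :
    (M • (Qᵀ * Q) + Pᵀ * P).IsSymm := by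
  simp [Matrix.IsSymm, Matrix.transpose_mul]

theorem dotProduct_transpose_mul_self_mulVec {n : Type*} [Fintype n] (P : Matrix n n ℝ)
    (v : n → ℝ) : (Pᵀ * P) *ᵥ v ⬝ᵥ v = P *ᵥ v ⬝ᵥ P *ᵥ v := by
  rw [← Matrix.mulVec_mulVec, Matrix.mulVec_transpose, ← Matrix.dotProduct_mulVec]

theorem dotProduct_add_self_le {n : Type*} [Fintype n] (a b : n → ℝ) :
    (a + b) ⬝ᵥ (a + b) ≤ 2 * (a ⬝ᵥ a + b ⬝ᵥ b) := by
  have key : 0 ≤ (a - b) ⬝ᵥ (a - b) := Finset.sum_nonneg fun i _ => mul_self_nonneg _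
  simp only [add_dotProduct, dotProduct_add, sub_dotProduct, dotProduct_sub] at key ⊢
  linarith

/-- If `P + Q = 1`, the symmetrizer `M·QᵀQ + PᵀP` is coercive with constant `min(M,1)/2`. -/
theorem min_half_mul_dotProduct_le_of_add_eq_one {n : Type*} [Fintype n] [DecidableEq n]
    {P Q : Matrix n n ℝ} (hPQ : P + Q = 1) {M : ℝ} (hM : 0 < M) (v : n → ℝ) :
    min M 1 / 2 * (v ⬝ᵥ v) ≤ (M • (Qᵀ * Q) + Pᵀ * P) *ᵥ v ⬝ᵥ v := by
  have hv : P *ᵥ v + Q *ᵥ v = v := by rw [← Matrix.add_mulVec, hPQ, Matrix.one_mulVec]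
  have hle := dotProduct_add_self_le (P *ᵥ v) (Q *ᵥ v)
  rw [hv] at hle
  rw [Matrix.add_mulVec, Matrix.smul_mulVec, add_dotProduct, smul_dotProduct, smul_eq_mul,
    dotProduct_transpose_mul_self_mulVec, dotProduct_transpose_mul_self_mulVec]
  have hP : 0 ≤ P *ᵥ v ⬝ᵥ P *ᵥ v := Finset.sum_nonneg fun i _ => mul_self_nonneg _
  have hQ : 0 ≤ Q *ᵥ v ⬝ᵥ Q *ᵥ v := Finset.sum_nonneg fun i _ => mul_self_nonneg _
  have hmin : 0 < min M 1 := lt_min hM one_pos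
  calc min M 1 / 2 * (v ⬝ᵥ v)
      ≤ min M 1 / 2 * (2 * (P *ᵥ v ⬝ᵥ P *ᵥ v + Q *ᵥ v ⬝ᵥ Q *ᵥ v)) := by gcongr
    _ = min M 1 * (Q *ᵥ v ⬝ᵥ Q *ᵥ v) + min M 1 * (P *ᵥ v ⬝ᵥ P *ᵥ v) := by ring
    _ ≤ M * (Q *ᵥ v ⬝ᵥ Q *ᵥ v) + 1 * (P *ᵥ v ⬝ᵥ P *ᵥ v) := by
      gcongr
      · exact min_le_left M 1
      · exact min_le_right M 1
    _ = M * (Q *ᵥ v ⬝ᵥ Q *ᵥ v) + P *ᵥ v ⬝ᵥ P *ᵥ v := by rw [one_mul]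

/-- First half of property (P1) of Lemma 3.2: for every `M > 0`, the symmetrizer
`S = M·P₋ᵀP₋ + P₊ᵀP₊` is symmetric and satisfies `⟨Sv, v⟩ ≥ α‖v‖²` with
`α = min(M,1)/2`. -/
theorem shallow_water_symmetrizer_coercive (g h q : ℝ) (hg : 0 < g) (hh : 0 < h)
    (hsub : q ^ 2 / h ^ 2 < g * h)
    (A : Matrix (Fin 2) (Fin 2) ℝ)
    (hA : A = !![0, 1; g * h - q ^ 2 / h ^ 2, 2 * q / h])
    (lp lm : ℝ)
    (hlp : lp = q / h + Real.sqrt (g * h))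
    (hlm : lm = q / h - Real.sqrt (g * h))
    (Pp Pm : Matrix (Fin 2) (Fin 2) ℝ)
    (hPp : Pp = (lp - lm)⁻¹ • (A - lm • (1 : Matrix (Fin 2) (Fin 2) ℝ)))
    (hPm : Pm = -((lp - lm)⁻¹ • (A - lp • (1 : Matrix (Fin 2) (Fin 2) ℝ))))
    (M : ℝ) (hM : 0 < M)
    (S : Matrix (Fin 2) (Fin 2) ℝ)
    (hS : S = M • (Pmᵀ * Pm) + Ppᵀ * Pp) :
    S.IsSymm ∧
    ∀ v : Fin 2 → ℝ, min M 1 / 2 * (v ⬝ᵥ v) ≤ S.mulVec v ⬝ᵥ v := by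
  have hne : lp - lm ≠ 0 := by
    have := Real.sqrt_pos.2 (mul_pos hg hh)
    rw [hlp, hlm]
    exact ne_of_gt (by linarith)
  have hsum : Pp + Pm = 1 := by
    rw [hPp, hPm, ← sub_eq_add_neg, ← smul_sub, sub_sub_sub_cancel_left, ← sub_smul, smul_smul,
      inv_mul_cancel₀ hne, one_smul]
  subst hS
  exact ⟨isSymm_smul_transpose_mul_self_add M Pp Pm,
    min_half_mul_dotProduct_le_of_add_eq_one hsum hM⟩
end

section
/- If the constant M satisfies M > 0 and M > −λ₊·⟨P₊·e₁, P₊·e₁⟩ / (λ₋·⟨P₋·e₁, P₋·e₁⟩), then ⟨S·A·w, w⟩ < 0 for every nonzero vector w ∈ ℝ² orthogonal to e₂; that is, S·A is negative definite on the kernel of the boundary condition, so the boundary condition is maximally dissipative (property (P2) of Lemma 3.2). -/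
open Matrix

/-- Property (P2) of Lemma 3.2: if `M > 0` and
`M > −λ₊⟨P₊e₁, P₊e₁⟩/(λ₋⟨P₋e₁, P₋e₁⟩)`, then `⟨SAw, w⟩ < 0` for every nonzero
vector `w` orthogonal to `e₂`, i.e. the boundary condition is maximally dissipative. -/
theorem shallow_water_maximally_dissipative (g h q : ℝ) (hg : 0 < g) (hh : 0 < h)
    (hsub : q ^ 2 / h ^ 2 < g * h)
    (A : Matrix (Fin 2) (Fin 2) ℝ)
    (hA : A = !![0, 1; g * h - q ^ 2 / h ^ 2, 2 * q / h])
    (lp lm : ℝ)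
    (hlp : lp = q / h + Real.sqrt (g * h))
    (hlm : lm = q / h - Real.sqrt (g * h))
    (Pp Pm : Matrix (Fin 2) (Fin 2) ℝ)
    (hPp : Pp = (lp - lm)⁻¹ • (A - lm • (1 : Matrix (Fin 2) (Fin 2) ℝ)))
    (hPm : Pm = -((lp - lm)⁻¹ • (A - lp • (1 : Matrix (Fin 2) (Fin 2) ℝ))))
    (M : ℝ) (hM : 0 < M)
    (hM' : M > -(lp * (Pp.mulVec ![1, 0] ⬝ᵥ Pp.mulVec ![1, 0])) /
      (lm * (Pm.mulVec ![1, 0] ⬝ᵥ Pm.mulVec ![1, 0])))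
    (S : Matrix (Fin 2) (Fin 2) ℝ)
    (hS : S = M • (Pmᵀ * Pm) + Ppᵀ * Pp) :
    ∀ w : Fin 2 → ℝ, w ≠ 0 → w ⬝ᵥ ![0, 1] = 0 →
      (S * A).mulVec w ⬝ᵥ w < 0 := by
  have hgh : 0 < g * h := mul_pos hg hh
  have hsq : Real.sqrt (g * h) ^ 2 = g * h := Real.sq_sqrt hgh.le
  have habs : |q / h| < Real.sqrt (g * h) := by
    apply abs_lt_of_sq_lt_sq _ (Real.sqrt_nonneg _)
    rw [hsq, div_pow]
    exact hsub
  obtain ⟨hl, hr⟩ := abs_lt.mp habs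
  have hlp_pos : 0 < lp := by linarith
  have hlm_neg : lm < 0 := by linarith
  have hA' : A = !![0, 1; -(lp * lm), lp + lm] := by
    have hdet : g * h - q ^ 2 / h ^ 2 = -(lp * lm) := by
      rw [hlp, hlm, ← div_pow]
      linear_combination -hsq
    have htr : 2 * q / h = lp + lm := by
      rw [hlp, hlm]
      ring
    rw [hA, hdet, htr]
  have hD : 0 < (lp - lm)⁻¹ := inv_pos.mpr (by linarith)
  generalize (lp - lm)⁻¹ = D at hPp hPm hD
  have hX : Pp.mulVec ![1, 0] ⬝ᵥ Pp.mulVec ![1, 0] = D ^ 2 * lm ^ 2 * (1 + lp ^ 2) := by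
    simp [hPp, hA', Matrix.mulVec, dotProduct, Fin.sum_univ_two]
    ring
  have hY : Pm.mulVec ![1, 0] ⬝ᵥ Pm.mulVec ![1, 0] = D ^ 2 * lp ^ 2 * (1 + lm ^ 2) := by
    simp [hPm, hA', Matrix.mulVec, dotProduct, Fin.sum_univ_two]
    ring
  rw [hX, hY] at hM'
  have hneg : lm * (D ^ 2 * lp ^ 2 * (1 + lm ^ 2)) < 0 :=
    mul_neg_of_neg_of_pos hlm_neg (by positivity)
  have hkey := (div_lt_iff_of_neg hneg).mp hM'
  intro w hw hw2
  have hw1 : w 1 = 0 := by simpa [dotProduct, Fin.sum_univ_two] using hw2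
  have hw0 : w 0 ≠ 0 := fun hw0 => hw (by ext i; fin_cases i <;> assumption)
  have hval : (S * A).mulVec w ⬝ᵥ w = w 0 ^ 2 *
      (M * (lm * (D ^ 2 * lp ^ 2 * (1 + lm ^ 2))) + lp * (D ^ 2 * lm ^ 2 * (1 + lp ^ 2))) := by
    simp [hS, hPp, hPm, hA', Matrix.mulVec, Matrix.mul_apply, dotProduct, Fin.sum_univ_two, hw1]
    ring
  rw [hval]
  exact mul_neg_of_pos_of_neg (by positivity) (by linarith)
end

section
/- Let B be a symmetric 2×2 real matrix. Then ⟨B·w, w⟩ < 0 for every nonzero vector w ∈ ℝ² orthogonal to e₂ = (0,1) if and only if there exist constants c₁ > 0 and c₂ > 0 such that for every vector v ∈ ℝ², −⟨B·v, v⟩ ≥ c₁·‖v‖² − c₂·|⟨e₂, v⟩|² (Métivier's lemma used in the proof of the L² a priori estimate, stated here for B = S·A). -/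
open Matrix

/-- Métivier's lemma: a symmetric 2×2 real matrix `B` satisfies `⟨Bw, w⟩ < 0` for every
nonzero `w` orthogonal to `e₂ = (0,1)` if and only if there are constants `c₁, c₂ > 0`
such that `−⟨Bv, v⟩ ≥ c₁‖v‖² − c₂|⟨e₂, v⟩|²` for every `v ∈ ℝ²`. -/
theorem metivier_negative_definite_on_kernel (B : Matrix (Fin 2) (Fin 2) ℝ)
    (hB : B.IsSymm) :
    (∀ w : Fin 2 → ℝ, w ≠ 0 → w ⬝ᵥ ![0, 1] = 0 → B.mulVec w ⬝ᵥ w < 0) ↔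
    (∃ c₁ > (0 : ℝ), ∃ c₂ > (0 : ℝ), ∀ v : Fin 2 → ℝ,
      c₁ * (v ⬝ᵥ v) - c₂ * ((![0, 1] : Fin 2 → ℝ) ⬝ᵥ v) ^ 2 ≤ -(B.mulVec v ⬝ᵥ v)) := by
  have hs : B 1 0 = B 0 1 := hB.apply 0 1
  constructor
  · intro h
    have ha : B 0 0 < 0 := by
      simpa [Matrix.mulVec, dotProduct, Fin.sum_univ_two] using
        h ![1, 0] (fun h0 => by simpa using congrFun h0 0)
          (by simp [dotProduct, Fin.sum_univ_two])
    obtain ⟨k, hk⟩ : ∃ k, k = -(B 0 0) / 2 := ⟨_, rfl⟩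
    have hk0 : 0 < k := by linarith
    refine ⟨k, hk0, k + |B 1 1| + B 0 1 ^ 2 / k, by positivity, fun v => ?_⟩
    have hsq : 0 ≤ k * v 0 ^ 2 - 2 * B 0 1 * v 0 * v 1 + B 0 1 ^ 2 / k * v 1 ^ 2 := by
      have : k * v 0 ^ 2 - 2 * B 0 1 * v 0 * v 1 + B 0 1 ^ 2 / k * v 1 ^ 2
          = (k * v 0 - B 0 1 * v 1) ^ 2 / k := by
        field_simp
        ring
      rw [this]
      positivity
    have hd : 0 ≤ (|B 1 1| - B 1 1) * v 1 ^ 2 :=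
      mul_nonneg (sub_nonneg.2 (le_abs_self _)) (sq_nonneg _)
    have haa : B 0 0 = -2 * k := by linarith
    simp only [Matrix.mulVec, dotProduct, Fin.sum_univ_two, Matrix.cons_val_zero,
      Matrix.cons_val_one, hs, haa]
    linarith
  · rintro ⟨c₁, hc₁, c₂, -, h⟩ w hw hw1
    replace hw1 : w 1 = 0 := by simpa [dotProduct, Fin.sum_univ_two] using hw1
    have hw0 : w 0 ≠ 0 := fun h0 => hw (by ext i; fin_cases i <;> simp [h0, hw1])
    have hpos : 0 < c₁ * (w 0 * w 0) := mul_pos hc₁ (mul_self_pos.2 hw0)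
    have := h w
    simp only [Matrix.mulVec, dotProduct, Fin.sum_univ_two, Matrix.cons_val_zero,
      Matrix.cons_val_one, hw1] at this ⊢
    linarith
end

section
/- For every integer k ≥ 1 there exists a constant C > 0, depending only on k, such that for every T > 0 and all functions f, g : ℝ → ℝ that are k times continuously differentiable on [0,T], one has the product estimate ‖f·g‖_{H^k((0,T))} ≤ C·( √T·‖f‖_{H^k((0,T))}·‖g‖_{H^k((0,T))} + (|f(0)| + |f⁽¹⁾(0)| + … + |f⁽ᵏ⁻¹⁾(0)|)·‖g‖_{H^k((0,T))} + (|g(0)| + |g⁽¹⁾(0)| + … + |g⁽ᵏ⁻¹⁾(0)|)·‖f‖_{H^k((0,T))} ). In particular the constant in front of ‖f‖·‖g‖ tends to 0 as T → 0 (Lemma 5.3 / Proposition B.1). -/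
open Set

/-- The `H^k((0,T))` norm of a function `f : ℝ → ℝ` (with derivatives taken within
`[0,T]`): `‖f‖_{H^k} = (Σ_{j≤k} ∫₀^T (f⁽ʲ⁾)²)^{1/2}`. -/
noncomputable def sobolevNormOn (k : ℕ) (T : ℝ) (f : ℝ → ℝ) : ℝ :=
  Real.sqrt (∑ j ∈ Finset.range (k + 1),
    ∫ t in (0 : ℝ)..T, (iteratedDerivWithin j f (Set.Icc 0 T) t) ^ 2)

open intervalIntegral

/-- Cauchy–Schwarz inequality for the integral of a continuous function against `1`. -/
theorem sq_integral_le_mul_integral_sq {a b : ℝ} (hab : a < b) {h : ℝ → ℝ}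
    (hh : ContinuousOn h (Icc a b)) :
    (∫ t in a..b, h t) ^ 2 ≤ (b - a) * ∫ t in a..b, h t ^ 2 := by
  set I := ∫ t in a..b, h t with hI
  have hba : 0 < b - a := sub_pos.2 hab
  have hint : IntervalIntegrable h MeasureTheory.volume a b := hh.intervalIntegrable_of_Icc hab.le
  have hint2 : IntervalIntegrable (fun t => h t ^ 2) MeasureTheory.volume a b :=
    (hh.pow 2).intervalIntegrable_of_Icc hab.le
  have hnonneg : 0 ≤ ∫ t in a..b, (h t - I / (b - a)) ^ 2 :=
    integral_nonneg hab.le fun t _ => sq_nonneg _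
  have hexpand : ∫ t in a..b, (h t - I / (b - a)) ^ 2
      = (∫ t in a..b, h t ^ 2) - I ^ 2 / (b - a) := by
    have : ∀ t, (h t - I / (b - a)) ^ 2
        = h t ^ 2 - (2 * (I / (b - a))) * h t + (I / (b - a)) ^ 2 := fun t => by ring
    simp_rw [this]
    rw [integral_add (hint2.sub (hint.const_mul _)) intervalIntegrable_const,
      integral_sub hint2 (hint.const_mul _), integral_const_mul, ← hI, integral_const,
      smul_eq_mul]
    field_simp
    ring
  rw [hexpand, sub_nonneg, div_le_iff₀ hba] at hnonneg
  linarith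

theorem sobolevNormOn_nonneg (k : ℕ) (T : ℝ) (f : ℝ → ℝ) : 0 ≤ sobolevNormOn k T f :=
  Real.sqrt_nonneg _

theorem integral_sq_iteratedDerivWithin_le_sobolevNormOn_sq {k j : ℕ} (hj : j ≤ k) {T : ℝ}
    (hT : 0 ≤ T) (f : ℝ → ℝ) :
    ∫ t in (0 : ℝ)..T, iteratedDerivWithin j f (Icc 0 T) t ^ 2 ≤ sobolevNormOn k T f ^ 2 := by
  have hnn : ∀ i ∈ Finset.range (k + 1),
      0 ≤ ∫ t in (0 : ℝ)..T, iteratedDerivWithin i f (Icc 0 T) t ^ 2 :=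
    fun i _ => integral_nonneg hT fun t _ => sq_nonneg _
  rw [sobolevNormOn, Real.sq_sqrt (Finset.sum_nonneg hnn)]
  exact Finset.single_le_sum hnn (Finset.mem_range.2 (Nat.lt_succ_of_le hj))

/-- Derivatives of order `i < k` are bounded by their value at `0` plus `√T` times the
`H^k` norm. -/
theorem abs_iteratedDerivWithin_le {k i : ℕ} (hi : i < k) {T : ℝ} (hT : 0 < T) {f : ℝ → ℝ}
    (hf : ContDiffOn ℝ k f (Icc 0 T)) {t : ℝ} (ht : t ∈ Icc 0 T) :
    |iteratedDerivWithin i f (Icc 0 T) t| ≤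
      |iteratedDerivWithin i f (Icc 0 T) 0| + Real.sqrt T * sobolevNormOn k T f := by
  have hud : UniqueDiffOn ℝ (Icc (0 : ℝ) T) := uniqueDiffOn_Icc hT
  set u := iteratedDerivWithin i f (Icc 0 T)
  set v := iteratedDerivWithin (i + 1) f (Icc 0 T) with hv
  have hvc : ContinuousOn v (Icc 0 T) :=
    hf.continuousOn_iteratedDerivWithin (by exact_mod_cast hi) hud
  have hud' : DifferentiableOn ℝ u (Icc 0 T) :=
    hf.differentiableOn_iteratedDerivWithin (by exact_mod_cast hi) hud
  rcases ht.1.eq_or_lt with rfl | ht0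
  · exact le_add_of_nonneg_right
      (mul_nonneg (Real.sqrt_nonneg _) (sobolevNormOn_nonneg _ _ _))
  have hsub : Icc 0 t ⊆ Icc 0 T := Icc_subset_Icc_right ht.2
  have hftc : ∫ s in (0 : ℝ)..t, v s = u t - u 0 := by
    refine integral_eq_sub_of_hasDerivAt_of_le ht0.le (hud'.continuousOn.mono hsub) ?_
      ((hvc.mono hsub).intervalIntegrable_of_Icc ht0.le)
    intro x hx
    have hxT : x ∈ Icc 0 T := hsub (Ioo_subset_Icc_self hx)
    rw [hv, iteratedDerivWithin_succ]
    exact (hud' x hxT).hasDerivWithinAt.hasDerivAt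
      (Icc_mem_nhds hx.1 (hx.2.trans_le ht.2))
  have hsq : (u t - u 0) ^ 2 ≤ (Real.sqrt T * sobolevNormOn k T f) ^ 2 := by
    rw [mul_pow, Real.sq_sqrt hT.le, ← hftc]
    calc (∫ s in (0 : ℝ)..t, v s) ^ 2 ≤ (t - 0) * ∫ s in (0 : ℝ)..t, v s ^ 2 :=
          sq_integral_le_mul_integral_sq ht0 (hvc.mono hsub)
      _ ≤ T * ∫ s in (0 : ℝ)..T, v s ^ 2 := by
          rw [sub_zero]
          refine mul_le_mul ht.2 ?_ (integral_nonneg ht0.le fun s _ => sq_nonneg _) hT.le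
          exact integral_mono_interval le_rfl ht0.le ht.2
            (Filter.Eventually.of_forall fun s => sq_nonneg _)
            ((hvc.pow 2).intervalIntegrable_of_Icc hT.le)
      _ ≤ T * sobolevNormOn k T f ^ 2 := by
          gcongr
          exact integral_sq_iteratedDerivWithin_le_sobolevNormOn_sq hi hT.le f
  have habs := abs_le_of_sq_le_sq hsq
    (mul_nonneg (Real.sqrt_nonneg _) (sobolevNormOn_nonneg _ _ _))
  have := abs_sub_abs_le_abs_sub (u t) (u 0)
  linarith

/-- `L²` bound for the product of two derivatives, the first of which has order less than `k`. -/
theorem integral_sq_mul_iteratedDerivWithin_le {k i j : ℕ} (hi : i < k) (hj : j ≤ k) {T : ℝ}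
    (hT : 0 < T) {f g : ℝ → ℝ} (hf : ContDiffOn ℝ k f (Icc 0 T))
    (hg : ContDiffOn ℝ k g (Icc 0 T)) :
    ∫ t in (0 : ℝ)..T,
        (iteratedDerivWithin i f (Icc 0 T) t * iteratedDerivWithin j g (Icc 0 T) t) ^ 2 ≤
      (Real.sqrt T * sobolevNormOn k T f * sobolevNormOn k T g
        + (∑ j ∈ Finset.range k, |iteratedDerivWithin j f (Icc 0 T) 0|) *
            sobolevNormOn k T g) ^ 2 := by
  have hud : UniqueDiffOn ℝ (Icc (0 : ℝ) T) := uniqueDiffOn_Icc hT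
  set A := ∑ j ∈ Finset.range k, |iteratedDerivWithin j f (Icc 0 T) 0|
  have hA : |iteratedDerivWithin i f (Icc 0 T) 0| ≤ A :=
    Finset.single_le_sum (f := fun j => |iteratedDerivWithin j f (Icc 0 T) 0|)
      (fun _ _ => abs_nonneg _) (Finset.mem_range.2 hi)
  have hfc : ContinuousOn (iteratedDerivWithin i f (Icc 0 T)) (Icc 0 T) :=
    hf.continuousOn_iteratedDerivWithin (by exact_mod_cast hi.le) hud
  have hgc : ContinuousOn (iteratedDerivWithin j g (Icc 0 T)) (Icc 0 T) :=
    hg.continuousOn_iteratedDerivWithin (by exact_mod_cast hj) hud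
  calc ∫ t in (0 : ℝ)..T,
        (iteratedDerivWithin i f (Icc 0 T) t * iteratedDerivWithin j g (Icc 0 T) t) ^ 2
      ≤ ∫ t in (0 : ℝ)..T, (A + Real.sqrt T * sobolevNormOn k T f) ^ 2 *
          iteratedDerivWithin j g (Icc 0 T) t ^ 2 := by
        refine integral_mono_on hT.le
          (((hfc.mul hgc).pow 2).intervalIntegrable_of_Icc hT.le)
          (((hgc.pow 2).intervalIntegrable_of_Icc hT.le).const_mul _) fun t ht => ?_
        rw [mul_pow, ← sq_abs (iteratedDerivWithin i f (Icc 0 T) t)]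
        gcongr
        exact (abs_iteratedDerivWithin_le hi hT hf ht).trans (by gcongr)
    _ ≤ (A + Real.sqrt T * sobolevNormOn k T f) ^ 2 * sobolevNormOn k T g ^ 2 := by
        rw [integral_const_mul]
        gcongr
        exact integral_sq_iteratedDerivWithin_le_sobolevNormOn_sq hj hT.le g
    _ = _ := by ring

/-- If the products of derivatives of total order at most `k` are bounded by `N` in `L²`, then
the `H^k` norm of the product is bounded by `N` up to a constant depending only on `k`. -/
theorem sobolevNormOn_mul_sq_le {k : ℕ} {T : ℝ} (hT : 0 < T) {f g : ℝ → ℝ}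
    (hf : ContDiffOn ℝ k f (Icc 0 T)) (hg : ContDiffOn ℝ k g (Icc 0 T)) {N : ℝ}
    (hN : ∀ i j : ℕ, i + j ≤ k → ∫ t in (0 : ℝ)..T,
      (iteratedDerivWithin i f (Icc 0 T) t * iteratedDerivWithin j g (Icc 0 T) t) ^ 2 ≤ N ^ 2) :
    sobolevNormOn k T (f * g) ^ 2 ≤
      (∑ n ∈ Finset.range (k + 1), ((n : ℝ) + 1) *
        ∑ i ∈ Finset.range (n + 1), (n.choose i : ℝ) ^ 2) * N ^ 2 := by
  have hud : UniqueDiffOn ℝ (Icc (0 : ℝ) T) := uniqueDiffOn_Icc hT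
  rw [sobolevNormOn, Real.sq_sqrt
    (Finset.sum_nonneg fun i _ => integral_nonneg hT.le fun t _ => sq_nonneg _), Finset.sum_mul]
  refine Finset.sum_le_sum fun n hn => ?_
  have hnk : n ≤ k := Nat.lt_succ_iff.1 (Finset.mem_range.1 hn)
  have hc : ∀ i ∈ Finset.range (n + 1), ContinuousOn (fun t =>
      (n.choose i : ℝ) ^ 2 * (iteratedDerivWithin i f (Icc 0 T) t *
        iteratedDerivWithin (n - i) g (Icc 0 T) t) ^ 2) (Icc 0 T) := by
    intro i hi
    have hin : i ≤ n := Nat.lt_succ_iff.1 (Finset.mem_range.1 hi)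
    exact continuousOn_const.mul
      (((hf.continuousOn_iteratedDerivWithin (by exact_mod_cast hin.trans hnk) hud).mul
        (hg.continuousOn_iteratedDerivWithin
          (by exact_mod_cast (Nat.sub_le n i).trans hnk) hud)).pow 2)
  have hfg : ContinuousOn (iteratedDerivWithin n (f * g) (Icc 0 T)) (Icc 0 T) :=
    (hf.mul hg).continuousOn_iteratedDerivWithin (by exact_mod_cast hnk) hud
  calc ∫ t in (0 : ℝ)..T, iteratedDerivWithin n (f * g) (Icc 0 T) t ^ 2
      ≤ ∫ t in (0 : ℝ)..T, ((n : ℝ) + 1) * ∑ i ∈ Finset.range (n + 1),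
          (n.choose i : ℝ) ^ 2 * (iteratedDerivWithin i f (Icc 0 T) t *
            iteratedDerivWithin (n - i) g (Icc 0 T) t) ^ 2 := by
        refine integral_mono_on hT.le ((hfg.pow 2).intervalIntegrable_of_Icc hT.le)
          ((continuousOn_const.mul
            (continuousOn_finsetSum _ hc)).intervalIntegrable_of_Icc hT.le) fun t ht => ?_
        have hn' : (n : WithTop ℕ∞) ≤ k := by exact_mod_cast hnk
        rw [iteratedDerivWithin_mul ht hud ((hf t ht).of_le hn') ((hg t ht).of_le hn')]
        refine sq_sum_le_card_mul_sum_sq.trans (le_of_eq ?_)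
        rw [Finset.card_range, Nat.cast_add_one]
        congr 1
        exact Finset.sum_congr rfl fun i _ => by ring
    _ = ((n : ℝ) + 1) * ∑ i ∈ Finset.range (n + 1), (n.choose i : ℝ) ^ 2 *
          ∫ t in (0 : ℝ)..T, (iteratedDerivWithin i f (Icc 0 T) t *
            iteratedDerivWithin (n - i) g (Icc 0 T) t) ^ 2 := by
        rw [integral_const_mul, integral_finsetSum fun i hi =>
          (hc i hi).intervalIntegrable_of_Icc hT.le]
        simp_rw [integral_const_mul]
    _ ≤ ((n : ℝ) + 1) * ∑ i ∈ Finset.range (n + 1), (n.choose i : ℝ) ^ 2 * N ^ 2 := by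
        gcongr with i hi
        have := Finset.mem_range.1 hi
        exact hN i (n - i) (by omega)
    _ = _ := by rw [← Finset.sum_mul, mul_assoc]

/-- Lemma 5.3 / Proposition B.1 (product estimate in `H^k((0,T))`): for every `k ≥ 1`
there is `C > 0` depending only on `k` such that for every `T > 0` and all `f, g`
`k` times continuously differentiable on `[0,T]`,
`‖fg‖_{H^k} ≤ C(√T‖f‖‖g‖ + (Σ_{j<k}|f⁽ʲ⁾(0)|)‖g‖ + (Σ_{j<k}|g⁽ʲ⁾(0)|)‖f‖)`. -/
theorem product_estimate_Hk (k : ℕ) (hk : 1 ≤ k) :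
    ∃ C > (0 : ℝ), ∀ T : ℝ, 0 < T → ∀ f g : ℝ → ℝ,
      ContDiffOn ℝ k f (Set.Icc 0 T) → ContDiffOn ℝ k g (Set.Icc 0 T) →
      sobolevNormOn k T (f * g) ≤
        C * (Real.sqrt T * sobolevNormOn k T f * sobolevNormOn k T g
          + (∑ j ∈ Finset.range k, |iteratedDerivWithin j f (Set.Icc 0 T) 0|) *
              sobolevNormOn k T g
          + (∑ j ∈ Finset.range k, |iteratedDerivWithin j g (Set.Icc 0 T) 0|) *
              sobolevNormOn k T f) := by
  set S : ℝ := ∑ n ∈ Finset.range (k + 1), ((n : ℝ) + 1) *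
    ∑ i ∈ Finset.range (n + 1), (n.choose i : ℝ) ^ 2
  refine ⟨Real.sqrt S + 1, by positivity, fun T hT f g hf hg => ?_⟩
  have hF := sobolevNormOn_nonneg k T f
  have hG := sobolevNormOn_nonneg k T g
  set F := sobolevNormOn k T f
  set G := sobolevNormOn k T g
  set A := ∑ j ∈ Finset.range k, |iteratedDerivWithin j f (Icc 0 T) 0|
  set B := ∑ j ∈ Finset.range k, |iteratedDerivWithin j g (Icc 0 T) 0|
  have hA0 : 0 ≤ A := Finset.sum_nonneg fun _ _ => abs_nonneg _
  have hB0 : 0 ≤ B := Finset.sum_nonneg fun _ _ => abs_nonneg _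
  set N := Real.sqrt T * F * G + A * G + B * F with hN
  have hN0 : 0 ≤ N := by positivity
  have hS0 : 0 ≤ S := by positivity
  have hbound : sobolevNormOn k T (f * g) ^ 2 ≤ S * N ^ 2 := by
    refine sobolevNormOn_mul_sq_le hT hf hg fun i j hij => ?_
    rcases lt_or_ge i k with hi | hi
    · refine (integral_sq_mul_iteratedDerivWithin_le hi (by omega) hT hf hg).trans ?_
      refine pow_le_pow_left₀ (by positivity) ?_ 2
      exact le_add_of_nonneg_right (by positivity)
    · simp_rw [mul_comm (iteratedDerivWithin i f (Icc 0 T) _)]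
      refine (integral_sq_mul_iteratedDerivWithin_le (by omega) (by omega) hT hg hf).trans ?_
      refine pow_le_pow_left₀ (by positivity) ?_ 2
      have : 0 ≤ A * G := by positivity
      rw [hN]
      linarith [mul_right_comm (Real.sqrt T) F G]
  calc sobolevNormOn k T (f * g) ≤ Real.sqrt (S * N ^ 2) := Real.le_sqrt_of_sq_le hbound
    _ = Real.sqrt S * N := by rw [Real.sqrt_mul hS0, Real.sqrt_sq hN0]
    _ ≤ (Real.sqrt S + 1) * N := by gcongr; linarith
end

section
/- Let g > 0, ρ > 0 and h₀ ∈ ℝ, let Ω be an open subset of {(t,r) ∈ ℝ² : r > 0}, and let ζ, q, P : ℝ² → ℝ be differentiable on Ω; set h = h₀ + ζ and assume h > 0 on Ω. If on Ω the axisymmetric shallow-water equations with surface pressure hold, namely ∂ₜh + ∂ᵣq + q/r = 0 and ∂ₜq + ∂ᵣ(q²/h) + q²/(r·h) + g·h·∂ᵣh = −(h/ρ)·∂ᵣP, then on Ω one has the local energy identity ∂ₜ𝔢 + ∂ᵣF = −r·q·∂ᵣP, where the local fluid energy is 𝔢 = (ρ/2)·g·ζ²·r + (ρ/2)·(q²/h)·r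 and the flux is F = ρ·r·(q³/(2h²) + g·ζ·q) (the conservative form (5.2) established in the proof of Proposition 2.5). -/
/-- Partial derivative with respect to the first (time) variable. -/
noncomputable def pdt (f : ℝ × ℝ → ℝ) (p : ℝ × ℝ) : ℝ :=
  deriv (fun s => f (s, p.2)) p.1

/-- Partial derivative with respect to the second (radial) variable. -/
noncomputable def pdr (f : ℝ × ℝ → ℝ) (p : ℝ × ℝ) : ℝ :=
  deriv (fun s => f (p.1, s)) p.2

theorem hasDerivAt_pdt {f : ℝ × ℝ → ℝ} {p : ℝ × ℝ} (hf : DifferentiableAt ℝ f p) :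
    HasDerivAt (fun s => f (s, p.2)) (pdt f p) p.1 := by
  have hc : DifferentiableAt ℝ (fun s : ℝ => (s, p.2)) p.1 := by fun_prop
  exact (DifferentiableAt.comp (g := f) p.1 hf hc).hasDerivAt

theorem hasDerivAt_pdr {f : ℝ × ℝ → ℝ} {p : ℝ × ℝ} (hf : DifferentiableAt ℝ f p) :
    HasDerivAt (fun s => f (p.1, s)) (pdr f p) p.2 := by
  have hc : DifferentiableAt ℝ (fun s : ℝ => (p.1, s)) p.2 := by fun_prop
  exact (DifferentiableAt.comp (g := f) p.2 hf hc).hasDerivAt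

/-- The conservative form (5.2): if `(ζ, q, P)` solve the axisymmetric shallow-water
equations with surface pressure on an open set `Ω ⊆ {r > 0}`, with `h = h₀ + ζ > 0`,
then the local energy identity `∂ₜ𝔢 + ∂ᵣF = −r q ∂ᵣP` holds on `Ω`, where
`𝔢 = (ρ/2)gζ²r + (ρ/2)(q²/h)r` and `F = ρr(q³/(2h²) + gζq)`. -/
theorem shallow_water_local_energy_identity
    (g ρ h₀ : ℝ) (hg : 0 < g) (hρ : 0 < ρ)
    (Ω : Set (ℝ × ℝ)) (hΩ : IsOpen Ω) (hΩr : ∀ p ∈ Ω, 0 < p.2)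
    (ζ q P : ℝ × ℝ → ℝ)
    (hζ : DifferentiableOn ℝ ζ Ω)
    (hq : DifferentiableOn ℝ q Ω)
    (hP : DifferentiableOn ℝ P Ω)
    (hpos : ∀ p ∈ Ω, 0 < h₀ + ζ p)
    (mass : ∀ p ∈ Ω,
      pdt (fun x => h₀ + ζ x) p + pdr q p + q p / p.2 = 0)
    (momentum : ∀ p ∈ Ω,
      pdt q p + pdr (fun x => (q x) ^ 2 / (h₀ + ζ x)) p
        + (q p) ^ 2 / (p.2 * (h₀ + ζ p))
        + g * (h₀ + ζ p) * pdr (fun x => h₀ + ζ x) p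
      = -((h₀ + ζ p) / ρ) * pdr P p) :
    ∀ p ∈ Ω,
      pdt (fun x => ρ / 2 * g * (ζ x) ^ 2 * x.2
          + ρ / 2 * ((q x) ^ 2 / (h₀ + ζ x)) * x.2) p
        + pdr (fun x => ρ * x.2 * ((q x) ^ 3 / (2 * (h₀ + ζ x) ^ 2)
          + g * ζ x * q x)) p
      = -(p.2 * q p * pdr P p) := by
  intro p hp
  have hr : p.2 ≠ 0 := (hΩr p hp).ne'
  have hh : h₀ + ζ p ≠ 0 := (hpos p hp).ne'
  have hρ0 : ρ ≠ 0 := hρ.ne'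
  have hΩp : Ω ∈ nhds p := hΩ.mem_nhds hp
  have ζt := hasDerivAt_pdt (hζ.differentiableAt hΩp)
  have ζr := hasDerivAt_pdr (hζ.differentiableAt hΩp)
  have qt := hasDerivAt_pdt (hq.differentiableAt hΩp)
  have qr := hasDerivAt_pdr (hq.differentiableAt hΩp)
  have ht : pdt (fun x => h₀ + ζ x) p = pdt ζ p := (ζt.const_add h₀).deriv
  have hr' : pdr (fun x => h₀ + ζ x) p = pdr ζ p := (ζr.const_add h₀).deriv
  have momentumFlux : pdr (fun x => (q x) ^ 2 / (h₀ + ζ x)) p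
      = 2 * q p * pdr q p / (h₀ + ζ p) - (q p) ^ 2 * pdr ζ p / (h₀ + ζ p) ^ 2 := by
    refine ((qr.pow 2).div (ζr.const_add h₀) hh).deriv.trans ?_
    simp only [Prod.mk.eta, Pi.pow_apply]
    field_simp
    ring
  have energy : pdt (fun x => ρ / 2 * g * (ζ x) ^ 2 * x.2
        + ρ / 2 * ((q x) ^ 2 / (h₀ + ζ x)) * x.2) p
      = ρ * p.2 * (g * ζ p * pdt ζ p + q p * pdt q p / (h₀ + ζ p)
        - (q p) ^ 2 * pdt ζ p / (2 * (h₀ + ζ p) ^ 2)) := by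
    refine ((((ζt.pow 2).const_mul (ρ / 2 * g)).mul_const p.2).add
      ((((qt.pow 2).div (ζt.const_add h₀) hh).const_mul (ρ / 2)).mul_const p.2)).deriv.trans ?_
    simp only [Prod.mk.eta, Pi.pow_apply]
    field_simp
    ring
  have energyFlux : pdr (fun x => ρ * x.2 * ((q x) ^ 3 / (2 * (h₀ + ζ x) ^ 2)
        + g * ζ x * q x)) p
      = ρ * ((q p) ^ 3 / (2 * (h₀ + ζ p) ^ 2) + g * ζ p * q p)
        + ρ * p.2 * (3 * (q p) ^ 2 * pdr q p / (2 * (h₀ + ζ p) ^ 2)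
          - (q p) ^ 3 * pdr ζ p / (h₀ + ζ p) ^ 3
          + g * pdr ζ p * q p + g * ζ p * pdr q p) := by
    have hh2 : 2 * (h₀ + ζ p) ^ 2 ≠ 0 := by positivity
    refine (((hasDerivAt_id p.2).const_mul ρ).mul
      (((qr.pow 3).div (((ζr.const_add h₀).pow 2).const_mul 2) hh2).add
        ((ζr.const_mul g).mul qr))).deriv.trans ?_
    simp only [Prod.mk.eta, Pi.pow_apply, Pi.add_apply, Pi.mul_apply, Pi.div_apply, id]
    field_simp
    ring
  have hmass := mass p hp
  have hmom := momentum p hp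
  rw [ht] at hmass
  rw [momentumFlux, hr'] at hmom
  rw [energy, energyFlux]
  have hpress : p.2 * q p * pdr P p
      = ρ * p.2 * q p / (h₀ + ζ p) * ((h₀ + ζ p) / ρ * pdr P p) := by
    field_simp
  rw [hpress]
  linear_combination (norm := skip)
    ρ * p.2 * (g * ζ p - (q p) ^ 2 / (2 * (h₀ + ζ p) ^ 2)) * hmass
      + ρ * p.2 * q p / (h₀ + ζ p) * hmom
  field_simp
  ring
end

section
/- Let R > 0, ρ > 0 and a ∈ ℝ. Let h : [0,R] → ℝ be continuous and everywhere positive, and let P : [0,R] → ℝ be continuous on [0,R], differentiable on (0,R), with P(R) = 0. Assume that the function r ↦ r·h(r)·P'(r) is differentiable on (0,R) with derivative equal to ρ·a·r (i.e. P solves the radial elliptic problem −(∂ᵣ + 1/r)((h/ρ)·∂ᵣP) = −a), and that r·h(r)·P'(r) → 0 as r → 0⁺. Then 2π·∫₀^R P(r)·r dr = −( (ρπ/2)·∫₀^R r³/h(r) dr )·a. (This is the added-mass identity F^II_fluid = −m_a^{NF}(h_w)·ẇ_G from Proposition 4.1 and Appendix A, with a = ẇ_G and m_a^{NF} = (ρπ/2)∫₀^R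 r³/h dr.) -/
open Set Filter Real

/-- A function with zero derivative on `(a, b)` and right limit `c` at `a` equals `c` on `(a, b)`. -/
theorem eq_of_hasDerivAt_zero_of_tendsto_nhdsGT {f : ℝ → ℝ} {a b c : ℝ}
    (hf : ∀ x ∈ Ioo a b, HasDerivAt f 0 x) (hlim : Tendsto f (nhdsWithin a (Ioi a)) (nhds c))
    {x : ℝ} (hx : x ∈ Ioo a b) : f x = c := by
  refine tendsto_nhds_unique (tendsto_const_nhds.congr' ?_) hlim
  filter_upwards [Ioo_mem_nhdsGT (hx.1.trans hx.2)] with y hy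
  exact isOpen_Ioo.is_const_of_deriv_eq_zero isPreconnected_Ioo
    (fun z hz => (hf z hz).differentiableAt.differentiableWithinAt)
    (fun z hz => (hf z hz).deriv) hx hy

/-- First integral of the radial elliptic problem: the flux `r h P'` equals `k r² / 2`. -/
theorem radial_flux_eq {q : ℝ → ℝ} {R k : ℝ} (hq : ∀ r ∈ Ioo 0 R, HasDerivAt q (k * r) r)
    (hlim : Tendsto q (nhdsWithin 0 (Ioi 0)) (nhds 0)) {r : ℝ} (hr : r ∈ Ioo 0 R) :
    q r = k * r ^ 2 / 2 := by
  have hd : ∀ x ∈ Ioo 0 R, HasDerivAt (fun s => q s - k * s ^ 2 / 2) 0 x := fun x hx => by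
    refine ((hq x hx).sub (((hasDerivAt_pow 2 x).const_mul k).div_const 2)).congr_deriv ?_
    push_cast
    ring
  have hc : Tendsto (fun s : ℝ => k * s ^ 2 / 2) (nhdsWithin 0 (Ioi 0)) (nhds 0) := by
    have : Continuous fun s : ℝ => k * s ^ 2 / 2 := by fun_prop
    simpa using (this.tendsto 0).mono_left nhdsWithin_le_nhds
  exact sub_eq_zero.mp
    (eq_of_hasDerivAt_zero_of_tendsto_nhdsGT hd (by simpa using hlim.sub hc) hr)

/-- The added-mass identity `F^II_fluid = −m_a^{NF}(h_w)·ẇ_G`: if `P` solves the radial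
elliptic problem `−(∂ᵣ + 1/r)((h/ρ)∂ᵣP) = −a` on `(0,R)` (i.e. `(r h P')' = ρ a r`),
with `P(R) = 0` and `r h P' → 0` as `r → 0⁺`, then
`2π ∫₀^R P r dr = −((ρπ/2) ∫₀^R r³/h dr)·a`. -/
theorem added_mass_identity (R ρ a : ℝ) (hR : 0 < R) (hρ : 0 < ρ)
    (h P : ℝ → ℝ)
    (hhc : ContinuousOn h (Set.Icc 0 R))
    (hhpos : ∀ r ∈ Set.Icc (0 : ℝ) R, 0 < h r)
    (hPc : ContinuousOn P (Set.Icc 0 R))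
    (hPd : ∀ r ∈ Set.Ioo (0 : ℝ) R, DifferentiableAt ℝ P r)
    (hPR : P R = 0)
    (hode : ∀ r ∈ Set.Ioo (0 : ℝ) R,
      HasDerivAt (fun s => s * h s * deriv P s) (ρ * a * r) r)
    (hlim : Filter.Tendsto (fun r => r * h r * deriv P r)
      (nhdsWithin 0 (Set.Ioi 0)) (nhds 0)) :
    2 * Real.pi * ∫ r in (0 : ℝ)..R, P r * r =
      -((ρ * Real.pi / 2) * ∫ r in (0 : ℝ)..R, r ^ 3 / h r) * a := by
  have hderiv : ∀ r ∈ Ioo 0 R, HasDerivAt (fun s => P s * s ^ 2)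
      (2 * (P r * r) + ρ * a / 2 * (r ^ 3 / h r)) r := fun r hr => by
    have hflux := radial_flux_eq hode hlim hr
    have hr0 : r ≠ 0 := hr.1.ne'
    have hh : h r ≠ 0 := (hhpos r (Ioo_subset_Icc_self hr)).ne'
    have hP' : deriv P r = ρ * a * r / (2 * h r) := by
      rw [eq_div_iff (by positivity)]
      apply mul_left_cancel₀ hr0
      linear_combination 2 * hflux
    refine ((hPd r hr).hasDerivAt.mul (hasDerivAt_pow 2 r)).congr_deriv ?_
    rw [hP']
    push_cast
    field_simp
    ring
  have hint₁ : IntervalIntegrable (fun r => P r * r) MeasureTheory.volume 0 R :=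
    (hPc.mul continuousOn_id).intervalIntegrable_of_Icc hR.le
  have hint₂ : IntervalIntegrable (fun r => r ^ 3 / h r) MeasureTheory.volume 0 R :=
    ((continuousOn_pow 3).div hhc fun r hr => (hhpos r hr).ne').intervalIntegrable_of_Icc hR.le
  have hftc := intervalIntegral.integral_eq_sub_of_hasDerivAt_of_le hR.le
    (hPc.mul (continuousOn_pow 2)) hderiv ((hint₁.const_mul 2).add (hint₂.const_mul (ρ * a / 2)))
  rw [intervalIntegral.integral_add (hint₁.const_mul 2) (hint₂.const_mul _),
    intervalIntegral.integral_const_mul, intervalIntegral.integral_const_mul] at hftc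
  simp only [Pi.mul_apply, hPR] at hftc
  linear_combination Real.pi * hftc
end
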